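/- Let L be a field of characteristic zero, let n ≥ 1, and let f ∈ L[x_0,…,x_n] be a homogeneous polynomial of degree d ≥ 1 satisfying Hypothesis (H). Let l0 ≥ 1 and, for 1 ≤ l ≤ l0, let g_l ∈ L[x_0,…,x_n] be homogeneous of degree l·d − (n+1) (possibly zero). If the fraction (Σ_{l=1}^{l0} g_l·f^{l0−l})/f^{l0} lies in D_f, then g_{l0} lies in the Jacobian ideal Jac f. (This is the linear independence, modulo derivatives, of Proposition 2: classes of g/f^l with g independent modulo Jac f are independent modulo D_f.) -/

import Mathlib

open MvPolynomial

section Koszul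

variable {R V : Type*} [CommRing R] [AddCommGroup V] [Module R V]

/-- Exactness of the Koszul complex of `F : V` modulo the ideal `J`, in degree `p + 1`: chains are
alternating forms on `V` and the differential is contraction with `F`. -/
def KoszulExact (F : V) (J : Ideal R) (p : ℕ) : Prop :=
  ∀ w : V [⋀^Fin (p + 1)]→ₗ[R] R, (∀ v, w.curryLeft F v ∈ J) →
    ∃ w' : V [⋀^Fin (p + 2)]→ₗ[R] R, ∀ v, w v - w'.curryLeft F v ∈ J

/-- Contraction with `F` and exterior multiplication by `φ` anticommute up to `φ F`. -/
theorem curryLeft_alternatizeUncurryFin_smulRight {p : ℕ} (F : V) (φ : V →ₗ[R] R)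
    (w : V [⋀^Fin (p + 1)]→ₗ[R] R) :
    (AlternatingMap.alternatizeUncurryFin (φ.smulRight w)).curryLeft F
      = φ F • w - AlternatingMap.alternatizeUncurryFin (φ.smulRight (w.curryLeft F)) := by
  ext v
  simp only [AlternatingMap.curryLeft_apply_apply, AlternatingMap.alternatizeUncurryFin_apply,
    AlternatingMap.sub_apply, AlternatingMap.smul_apply, LinearMap.smulRight_apply]
  rw [Fin.sum_univ_succ, sub_eq_add_neg, ← Finset.sum_neg_distrib]
  congr 1
  · simp
  · refine Finset.sum_congr rfl fun i _ => ?_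
    have h : i.succ.removeNth (Matrix.vecCons F v) = Matrix.vecCons F (i.removeNth v) := by
      ext j
      refine Fin.cases ?_ (fun j => ?_) j <;> simp [Fin.removeNth]
    rw [h]
    simp [pow_succ]

/-- An alternating form with values in `J ⊔ (y)` splits into a multiple of `y` and a form with
values in `J`. -/
theorem exists_alternatingMap_smul_sub_mem [Module.Free R V] {p : ℕ} (J : Ideal R) (y : R)
    (u : V [⋀^Fin p]→ₗ[R] R) (hu : ∀ v, u v ∈ J ⊔ Ideal.span {y}) :
    ∃ u' : V [⋀^Fin p]→ₗ[R] R, ∀ v, u v - y * u' v ∈ J := by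
  let θ : R × J →ₗ[R] R := (LinearMap.toSpanSingleton R R y).coprod J.subtype
  have hθ : ∀ v, u v ∈ LinearMap.range θ := fun v => by
    obtain ⟨j, hj, z, hz, h⟩ := Submodule.mem_sup.mp (hu v)
    obtain ⟨r, rfl⟩ := Ideal.mem_span_singleton'.mp hz
    exact ⟨(r, ⟨j, hj⟩), by simp [θ, ← h, add_comm]⟩
  obtain ⟨k, hk⟩ := Module.projective_lifting_property θ.rangeRestrict
    (exteriorPower.alternatingMapLinearEquiv (u.codRestrict (LinearMap.range θ) hθ))
    θ.surjective_rangeRestrict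
  refine ⟨((LinearMap.fst R R J).comp k).compAlternatingMap (exteriorPower.ιMulti R p),
    fun v => ?_⟩
  have h := congrArg Subtype.val (LinearMap.congr_fun hk (exteriorPower.ιMulti R p v))
  rw [exteriorPower.alternatingMapLinearEquiv_apply_ιMulti] at h
  change θ (k _) = u v at h
  rw [← h]
  simp [θ, mul_comm]

theorem KoszulExact.of_sup_span [Module.Free R V] {F : V} {J : Ideal R} {p : ℕ}
    (φ : V →ₗ[R] R) (hreg : ∀ r, φ F * r ∈ J → r ∈ J)
    (h : KoszulExact F (J ⊔ Ideal.span {φ F}) (p + 1)) : KoszulExact F J p := by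
  intro w hw
  have hH := curryLeft_alternatizeUncurryFin_smulRight F φ w
  set H := AlternatingMap.alternatizeUncurryFin (φ.smulRight w)
  have hHJ : ∀ v, φ F * w v - H.curryLeft F v ∈ J := fun v => by
    rw [hH]
    simp only [AlternatingMap.sub_apply, AlternatingMap.smul_apply, smul_eq_mul, sub_sub_cancel,
      AlternatingMap.alternatizeUncurryFin_apply, LinearMap.smulRight_apply]
    refine Ideal.sum_mem _ fun i _ => ?_
    exact zsmul_mem (J.mul_mem_left _ (hw _)) _
  obtain ⟨v', hv'⟩ := h H fun v => by
    rw [← sub_sub_cancel (φ F * w v) (H.curryLeft F v)]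
    exact sub_mem (Ideal.mem_sup_right (Ideal.mul_mem_right _ _ (Ideal.mem_span_singleton_self _)))
      (Ideal.mem_sup_left (hHJ v))
  obtain ⟨u', hu'⟩ := exists_alternatingMap_smul_sub_mem J (φ F) (H - v'.curryLeft F) hv'
  refine ⟨u', fun v => hreg _ ?_⟩
  have h₁ := hu' (Matrix.vecCons F v)
  have h₂ : (v'.curryLeft F) (Matrix.vecCons F v) = 0 := by
    rw [← AlternatingMap.curryLeft_apply_apply, AlternatingMap.curryLeft_same,
      AlternatingMap.zero_apply]
  rw [AlternatingMap.sub_apply, h₂, sub_zero] at h₁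
  have h₃ := add_mem (hHJ v) h₁
  simp only [AlternatingMap.curryLeft_apply_apply] at h₃ ⊢
  convert h₃ using 1
  ring

theorem koszulExact_of_le {s p : ℕ} (hp : s ≤ p) (F : Fin s → R) (J : Ideal R) :
    KoszulExact F J p := by
  intro w _
  have hw : w = 0 := (Pi.basisFun R (Fin s)).ext_alternating fun v hv => by
    have := Fintype.card_le_of_injective v hv
    simp only [Fintype.card_fin] at this
    omega
  exact ⟨0, fun v => by simp [hw]⟩

/-- If the ideal generated by `F` contains a weakly regular sequence as long as `F`,
then every syzygy of `F` is a Koszul syzygy. -/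
theorem exists_skew_of_sum_mul_eq_zero {s : ℕ} (F y : Fin s → R)
    (hy : ∀ k, y k ∈ Ideal.span (Set.range F))
    (hreg : ∀ k r, y k * r ∈ Ideal.span (y '' {i | i < k}) → r ∈ Ideal.span (y '' {i | i < k}))
    (b : Fin s → R) (hb : ∑ i, b i * F i = 0) :
    ∃ h : Fin s → Fin s → R, (∀ i j, h j i = -h i j) ∧ ∀ i, b i = ∑ j, h i j * F j := by
  have key : ∀ k ≤ s, KoszulExact F (Ideal.span (y '' {i | (i : ℕ) < k})) k := by
    intro k hk
    induction hk using Nat.decreasingInduction with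
    | self => exact koszulExact_of_le le_rfl _ _
    | of_succ k hk ih =>
      obtain ⟨c, hc⟩ := Ideal.mem_span_range_iff_exists_fun.mp (hy ⟨k, hk⟩)
      have hφ : Fintype.linearCombination R c F = y ⟨k, hk⟩ := by
        simp [Fintype.linearCombination_apply, ← hc, mul_comm]
      refine KoszulExact.of_sup_span (Fintype.linearCombination R c) ?_ ?_
      · rw [hφ]
        exact hreg ⟨k, hk⟩
      · rw [hφ, ← Ideal.span_union, ← Set.image_singleton, ← Set.image_union]
        convert ih using 4
        ext i
        simp [Fin.ext_iff]
        omega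
  obtain ⟨w', hw'⟩ := key 0 (Nat.zero_le _)
    (AlternatingMap.ofSubsingleton R (Fin s → R) R (0 : Fin 1)
      (Fintype.linearCombination R b)) fun v => by
        simp [Fintype.linearCombination_apply, mul_comm (F _), hb]
  simp only [not_lt_zero, Set.ofPred_false, Set.image_empty, Ideal.span_empty, Ideal.mem_bot,
    sub_eq_zero] at hw'
  refine ⟨fun i j => w' ![Pi.single j 1, Pi.single i 1], fun i j => ?_, fun i => ?_⟩
  · have := w'.map_swap ![Pi.single j 1, Pi.single i 1] (i := 0) (j := 1) (by simp)
    rw [← this]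
    refine congrArg w' (funext fun k => ?_)
    fin_cases k <;> simp
  · have h₁ := hw' ![Pi.single i 1]
    have h₂ : F = ∑ j, F j • (Pi.single j 1 : Fin s → R) := by
      ext j
      simp [Finset.sum_apply, Pi.single_apply]
    have h₃ : w'.curryLeft F ![Pi.single i 1]
        = ∑ j, F j * w' ![Pi.single j 1, Pi.single i 1] := by
      let ev : (Fin s → R) →ₗ[R] R :=
        { toFun := fun x => w'.curryLeft x ![Pi.single i 1]
          map_add' := fun x y => by rw [map_add, AlternatingMap.add_apply]
          map_smul' := fun r x => by rw [map_smul, AlternatingMap.smul_apply, RingHom.id_apply] }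
      change ev F = _
      conv_lhs => rw [h₂, map_sum]
      simp [ev]
    rw [h₃] at h₁
    simpa [Fintype.linearCombination_apply, mul_comm, Pi.single_apply] using h₁

end Koszul

section Homogeneous

variable {σ L : Type*} [Field L]

theorem pderiv_homogeneousComponent (i : σ) (k : ℕ) (p : MvPolynomial σ L) :
    pderiv i (homogeneousComponent (k + 1) p) = homogeneousComponent k (pderiv i p) := by
  ext m
  simp only [coeff_pderiv, coeff_homogeneousComponent, map_add, Finsupp.degree_single,
    add_left_inj]
  split_ifs <;> simp

theorem homogeneousComponent_mul_of_isHomogeneous {p : MvPolynomial σ L} {d : ℕ}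
    (hp : p.IsHomogeneous d) (k : ℕ) (q : MvPolynomial σ L) :
    homogeneousComponent (d + k) (p * q) = p * homogeneousComponent k q := by
  classical
  let := MvPolynomial.gradedAlgebra (σ := σ) (R := L)
  have h := DirectSum.coe_decompose_mul_of_left_mem_of_le (homogeneousSubmodule σ L)
    (b := q) ((mem_homogeneousSubmodule d p).mpr hp) (Nat.le_add_right d k)
  rw [Nat.add_sub_cancel_left] at h
  rw [← decomposition.decompose'_apply, ← decomposition.decompose'_apply]
  exact h

theorem pderiv_comm (i j : σ) (p : MvPolynomial σ L) :
    pderiv i (pderiv j p) = pderiv j (pderiv i p) := by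
  classical
  ext m
  by_cases h : i = j
  · rw [h]
  · simp only [coeff_pderiv, Finsupp.add_apply, Finsupp.single_apply, h, Ne.symm h, if_false,
      add_right_comm m]
    push_cast
    ring

/-- A homogeneous ideal of finite codimension contains a power of each variable. -/
theorem exists_X_pow_mem_of_finite {I : Ideal (MvPolynomial σ L)}
    (hI : letI := MvPolynomial.gradedAlgebra (σ := σ) (R := L)
      I.IsHomogeneous (homogeneousSubmodule σ L))
    (hfin : Module.Finite L (MvPolynomial σ L ⧸ I)) (i : σ) : ∃ N : ℕ, X i ^ N ∈ I := by
  obtain ⟨P, hP, hP0⟩ := Algebra.IsIntegral.isIntegral (R := L) (Ideal.Quotient.mk I (X i))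
  have hmem : Polynomial.aeval (X i : MvPolynomial σ L) P ∈ I := by
    rw [← Ideal.Quotient.eq_zero_iff_mem, ← Ideal.Quotient.mkₐ_eq_mk L,
      ← Polynomial.aeval_algHom_apply]
    exact hP0
  refine ⟨P.natDegree, ?_⟩
  have h := homogeneousComponent_mem_of_mem hI hmem P.natDegree
  rw [Polynomial.aeval_eq_sum_range, map_sum, Finset.sum_eq_single P.natDegree] at h
  · rwa [hP.coeff_natDegree, one_smul,
      homogeneousComponent_eq_self (isHomogeneous_X_pow i _)] at h
  · intro k _ hk
    rw [map_smul, homogeneousComponent_of_mem (isHomogeneous_X_pow i k), if_neg hk.symm,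
      smul_zero]
  · simp

/-- Powers of distinct variables form a regular sequence. -/
theorem mem_span_X_pow_of_X_pow_mul_mem (N : σ → ℕ) {s : Set σ} {k : σ} (hk : k ∉ s)
    {r : MvPolynomial σ L}
    (h : X k ^ N k * r ∈ Ideal.span ((fun i => (X i : MvPolynomial σ L) ^ N i) '' s)) :
    r ∈ Ideal.span ((fun i => (X i : MvPolynomial σ L) ^ N i) '' s) := by
  classical
  have hs : (fun i => (X i : MvPolynomial σ L) ^ N i) '' s
      = (fun m => monomial m (1 : L)) '' ((fun i => Finsupp.single i (N i)) '' s) := by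
    simp [Set.image_image, X_pow_eq_monomial]
  rw [hs, mem_ideal_span_monomial_image] at h ⊢
  intro m hm
  obtain ⟨_, ⟨i, hi, rfl⟩, hle⟩ := h (Finsupp.single k (N k) + m) (by
    rw [X_pow_eq_monomial, mem_support_iff, coeff_monomial_mul, one_mul]
    exact mem_support_iff.mp hm)
  refine ⟨_, ⟨i, hi, rfl⟩, ?_⟩
  have hik : k ≠ i := fun h => hk (h ▸ hi)
  rw [Finsupp.single_le_iff] at hle ⊢
  simpa [Finsupp.single_apply, hik] using hle

end Homogeneous

section PoleReduction

variable {σ L : Type*} [Field L] [Fintype σ]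

theorem sum_sum_mul_eq_zero_of_skew [CharZero L] {h s : σ → σ → MvPolynomial σ L}
    (hh : ∀ i j, h j i = -h i j) (hs : ∀ i j, s j i = s i j) :
    ∑ i, ∑ j, h i j * s i j = 0 := by
  rw [← self_eq_neg]
  conv_lhs => rw [Finset.sum_comm]
  simp_rw [← Finset.sum_neg_distrib]
  exact Finset.sum_congr rfl fun i _ => Finset.sum_congr rfl fun j _ => by rw [hh, hs, neg_mul]

theorem sum_pderiv_sum_pderiv_eq_zero_of_skew [CharZero L] {h : σ → σ → MvPolynomial σ L}
    (hh : ∀ i j, h j i = -h i j) : ∑ j, pderiv j (∑ i, pderiv i (h i j)) = 0 := by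
  simp_rw [map_sum]
  rw [← self_eq_neg]
  conv_lhs => rw [Finset.sum_comm]
  simp_rw [← Finset.sum_neg_distrib]
  exact Finset.sum_congr rfl fun i _ => Finset.sum_congr rfl fun j _ => by
    rw [hh j i, map_neg, map_neg, pderiv_comm]

/-- The numerator of the divergence of `b / f ^ m`, when `b` is the sum of a multiple of the Euler
field of total weight zero and of a Koszul syzygy. -/
theorem divergence_numerator_eq [CharZero L] {f c : MvPolynomial σ L} {d k m : ℕ}
    (hf : f.IsHomogeneous d) (hc : c.IsHomogeneous k) (hk : k + Fintype.card σ = m * d)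
    {h : σ → σ → MvPolynomial σ L} (hh : ∀ i j, h j i = -h i j) :
    ∑ i, (f * pderiv i (c * X i + ∑ j, h i j * pderiv j f)
        - (m : MvPolynomial σ L) * (c * X i + ∑ j, h i j * pderiv j f) * pderiv i f)
      = f * ∑ j, (∑ i, pderiv i (h i j)) * pderiv j f := by
  have hEf : ∑ i, X i * pderiv i f = (d : MvPolynomial σ L) * f := by
    rw [hf.sum_X_mul_pderiv, nsmul_eq_mul]
  have hEc : ∑ i, X i * pderiv i c = (k : MvPolynomial σ L) * c := by
    rw [hc.sum_X_mul_pderiv, nsmul_eq_mul]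
  have hk' : (k : MvPolynomial σ L) + (Fintype.card σ : MvPolynomial σ L) = m * d := by
    exact_mod_cast congrArg (Nat.cast (R := MvPolynomial σ L)) hk
  have h₁ := sum_sum_mul_eq_zero_of_skew hh (s := fun i j => pderiv i (pderiv j f))
    fun i j => pderiv_comm _ _ _
  have h₂ := sum_sum_mul_eq_zero_of_skew hh (s := fun i j => pderiv i f * pderiv j f)
    fun i j => mul_comm _ _
  have h₃ : ∑ j, (∑ i, pderiv i (h i j)) * pderiv j f
      = ∑ i, ∑ j, pderiv i (h i j) * pderiv j f := by
    simp_rw [Finset.sum_mul]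
    exact Finset.sum_comm
  have h₄ : ∑ i, (f * pderiv i (c * X i + ∑ j, h i j * pderiv j f)
        - (m : MvPolynomial σ L) * (c * X i + ∑ j, h i j * pderiv j f) * pderiv i f)
      = f * ∑ i, X i * pderiv i c + f * (Fintype.card σ * c)
        - m * c * ∑ i, X i * pderiv i f
        + f * ∑ i, ∑ j, pderiv i (h i j) * pderiv j f
        + f * ∑ i, ∑ j, h i j * pderiv i (pderiv j f)
        - m * ∑ i, ∑ j, h i j * (pderiv i f * pderiv j f) := by
    have hcard : (Fintype.card σ * c : MvPolynomial σ L) = ∑ _i : σ, c := by simp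
    rw [hcard]
    simp only [Finset.mul_sum, ← Finset.sum_add_distrib, ← Finset.sum_sub_distrib]
    refine Finset.sum_congr rfl fun i _ => ?_
    simp only [map_add, map_sum, pderiv_mul, pderiv_X_self, mul_add, add_mul, Finset.sum_mul,
      Finset.mul_sum, Finset.sum_add_distrib]
    have e : ∑ j, (m : MvPolynomial σ L) * (h i j * pderiv j f) * pderiv i f
        = ∑ j, (m : MvPolynomial σ L) * (h i j * (pderiv i f * pderiv j f)) :=
      Finset.sum_congr rfl fun j _ => by ring
    rw [e]
    ring
  rw [h₄, h₁, h₂, h₃, hEf, hEc]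
  linear_combination f * c * hk'

end PoleReduction

section Jacobian

theorem isHomogeneous_jacobian {σ L : Type*} [Field L] {f : MvPolynomial σ L} {d : ℕ}
    (hf : f.IsHomogeneous d) :
    letI := MvPolynomial.gradedAlgebra (σ := σ) (R := L)
    (Ideal.span (Set.range fun i => pderiv i f)).IsHomogeneous (homogeneousSubmodule σ L) := by
  let := MvPolynomial.gradedAlgebra (σ := σ) (R := L)
  refine Ideal.homogeneous_span _ _ ?_
  rintro _ ⟨i, rfl⟩
  exact ⟨d - 1, hf.pderiv⟩

/-- If the Jacobian ideal has finite codimension, the syzygies of the partial derivatives are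
the Koszul ones. -/
theorem exists_skew_of_sum_mul_pderiv_eq_zero {L : Type*} [Field L] {s : ℕ} {f : MvPolynomial (Fin s) L} {d : ℕ}
    (hf : f.IsHomogeneous d)
    (hH : Module.Finite L
      (MvPolynomial (Fin s) L ⧸ Ideal.span (Set.range fun i => pderiv i f)))
    (b : Fin s → MvPolynomial (Fin s) L) (hb : ∑ i, b i * pderiv i f = 0) :
    ∃ h : Fin s → Fin s → MvPolynomial (Fin s) L,
      (∀ i j, h j i = -h i j) ∧ ∀ i, b i = ∑ j, h i j * pderiv j f := by
  choose N hN using exists_X_pow_mem_of_finite (isHomogeneous_jacobian hf) hH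
  exact exists_skew_of_sum_mul_eq_zero _ (fun i => X i ^ N i) hN
    (fun k _ => mem_span_X_pow_of_X_pow_mul_mem N (by simp)) b hb

variable {σ L : Type*} [Field L] [CharZero L] [Fintype σ]

theorem self_mem_jacobian {f : MvPolynomial σ L} {d : ℕ} (hd : d ≠ 0) (hf : f.IsHomogeneous d) :
    f ∈ Ideal.span (Set.range fun i => pderiv i f) := by
  have hEf := hf.sum_X_mul_pderiv
  have hdf : C (d : L)⁻¹ * (d • f) = f := by
    rw [nsmul_eq_mul, ← mul_assoc, ← map_natCast (C (R := L) (σ := σ)), ← C_mul,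
      inv_mul_cancel₀ (Nat.cast_ne_zero.mpr hd), C_1, one_mul]
  have hmem : C (d : L)⁻¹ * ∑ i, X i * pderiv i f ∈ Ideal.span (Set.range fun i => pderiv i f) :=
    Ideal.mul_mem_left _ _ (Ideal.sum_mem _ fun i _ =>
      Ideal.mul_mem_left _ _ (Ideal.subset_span ⟨i, rfl⟩))
  rwa [hEf, hdf] at hmem

/-- Reduction of the pole order by one, modulo a form in the Jacobian ideal. -/
theorem exists_divergence_free_of_divergence_eq {s : ℕ} {f A : MvPolynomial (Fin s) L}
    {d k m : ℕ} (hd : 1 ≤ d) (hf : f.IsHomogeneous d) (hf0 : f ≠ 0)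
    (hH : Module.Finite L
      (MvPolynomial (Fin s) L ⧸ Ideal.span (Set.range fun i => pderiv i f)))
    (hm : m ≠ 0) (hk : k + s = m * d) (hA : A.IsHomogeneous k)
    (b : Fin s → MvPolynomial (Fin s) L)
    (hb : f * A = ∑ i, (f * pderiv i (b i) - (m : MvPolynomial (Fin s) L) * b i * pderiv i f)) :
    ∃ c : Fin s → MvPolynomial (Fin s) L,
      ∑ j, pderiv j (c j) = 0 ∧ A = ∑ j, c j * pderiv j f := by
  have hC : ∀ {a : ℕ}, a ≠ 0 →
      C (a : L)⁻¹ * (a : MvPolynomial (Fin s) L) = 1 := fun {a} ha => by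
    rw [← map_natCast (C (R := L) (σ := Fin s)), ← C_mul,
      inv_mul_cancel₀ (Nat.cast_ne_zero.mpr ha), C_1]
  let β : Fin s → MvPolynomial (Fin s) L := fun i => homogeneousComponent (k + 1) (b i)
  have hβ : f * A
      = ∑ i, (f * pderiv i (β i) - (m : MvPolynomial (Fin s) L) * β i * pderiv i f) := by
    have h := congrArg (homogeneousComponent (d + k)) hb
    rw [homogeneousComponent_eq_self (hf.mul hA), map_sum] at h
    rw [h]
    refine Finset.sum_congr rfl fun i _ => ?_
    have e : (m : MvPolynomial (Fin s) L) * b i * pderiv i f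
        = ((m : MvPolynomial (Fin s) L) * pderiv i f) * b i := by ring
    have hmf : ((m : MvPolynomial (Fin s) L) * pderiv i f).IsHomogeneous (d - 1) := by
      rw [← map_natCast (C (R := L) (σ := Fin s))]
      exact hf.pderiv.C_mul _
    rw [map_sub, homogeneousComponent_mul_of_isHomogeneous hf, e,
      show d + k = d - 1 + (k + 1) by omega, homogeneousComponent_mul_of_isHomogeneous hmf,
      ← pderiv_homogeneousComponent]
    ring
  set γ : MvPolynomial (Fin s) L := C (m : L)⁻¹ * (∑ i, pderiv i (β i) - A)
  have hγ : γ.IsHomogeneous k := by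
    refine IsHomogeneous.C_mul (IsHomogeneous.sub (IsHomogeneous.sum _ _ _ fun i _ => ?_) hA) _
    exact (homogeneousComponent_isHomogeneous (k + 1) (b i)).pderiv
  have hγf : ∑ i, β i * pderiv i f = γ * f := by
    rw [Finset.sum_sub_distrib, ← Finset.mul_sum] at hβ
    have e : ∑ i, (m : MvPolynomial (Fin s) L) * β i * pderiv i f
        = m * ∑ i, β i * pderiv i f := by
      simp_rw [Finset.mul_sum, mul_assoc]
    rw [e] at hβ
    linear_combination (-∑ i, β i * pderiv i f) * hC hm + C (m : L)⁻¹ * hβ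
  have hEf : ∑ i, X i * pderiv i f = (d : MvPolynomial (Fin s) L) * f := by
    rw [hf.sum_X_mul_pderiv, nsmul_eq_mul]
  obtain ⟨h, hh, hbh⟩ := exists_skew_of_sum_mul_pderiv_eq_zero hf hH
    (fun i => β i - C (d : L)⁻¹ * γ * X i) (by
      have e : ∑ i, (C (d : L)⁻¹ * γ * X i) * pderiv i f
          = C (d : L)⁻¹ * γ * ∑ i, X i * pderiv i f := by
        simp_rw [Finset.mul_sum, mul_assoc]
      simp_rw [sub_mul]
      rw [Finset.sum_sub_distrib, e, hEf, hγf]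
      linear_combination (-γ * f) * hC (a := d) (by omega))
  refine ⟨fun j => ∑ i, pderiv i (h i j), sum_pderiv_sum_pderiv_eq_zero_of_skew hh, ?_⟩
  have hβ' : β = fun i => C (d : L)⁻¹ * γ * X i + ∑ j, h i j * pderiv j f := by
    funext i
    rw [← hbh i]
    ring
  refine mul_left_cancel₀ hf0 ?_
  rw [hβ, hβ']
  exact divergence_numerator_eq hf (hγ.C_mul _) (by simpa using hk) hh

theorem mem_jacobian_of_divergence_eq {s : ℕ} {f a : MvPolynomial (Fin s) L} {d l : ℕ}
    (hd : 1 ≤ d) (hf : f.IsHomogeneous d) (hf0 : f ≠ 0)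
    (hH : Module.Finite L
      (MvPolynomial (Fin s) L ⧸ Ideal.span (Set.range fun i => pderiv i f)))
    (hl : 1 ≤ l) (hs : s ≤ l * d) (ha : a.IsHomogeneous (l * d - s)) (m : ℕ)
    (b : Fin s → MvPolynomial (Fin s) L)
    (hb : a * f ^ (m + 1) = f ^ l *
      ∑ i, (f * pderiv i (b i) - (m : MvPolynomial (Fin s) L) * b i * pderiv i f)) :
    a ∈ Ideal.span (Set.range fun i => pderiv i f) := by
  induction m generalizing b with
  | zero =>
    obtain ⟨l, rfl⟩ := Nat.exists_eq_add_of_le' hl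
    have h : a = f ^ (l + 1) * ∑ i, pderiv i (b i) := by
      refine mul_right_cancel₀ (pow_ne_zero (0 + 1) hf0) (hb.trans ?_)
      simp only [Nat.cast_zero, zero_mul, sub_zero, ← Finset.mul_sum]
      ring
    rw [h]
    exact Ideal.mul_mem_right _ _ (Ideal.pow_mem_of_mem _
      (self_mem_jacobian (by omega) hf) _ (Nat.succ_pos l))
  | succ m ih =>
    rcases lt_or_ge (m + 1) l with hml | hml
    · obtain ⟨e, rfl⟩ := Nat.exists_eq_add_of_lt hml
      have h : a = f ^ e * ∑ i, (f * pderiv i (b i)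
          - ((m + 1 : ℕ) : MvPolynomial (Fin s) L) * b i * pderiv i f) := by
        refine mul_right_cancel₀ (pow_ne_zero (m + 1 + 1) hf0) (hb.trans ?_)
        ring
      rw [h]
      exact Ideal.mul_mem_left _ _ (Ideal.sum_mem _ fun i _ => sub_mem
        (Ideal.mul_mem_right _ _ (self_mem_jacobian (by omega) hf))
        (Ideal.mul_mem_left _ _ (Ideal.subset_span ⟨i, rfl⟩)))
    · obtain ⟨e, he⟩ := Nat.exists_eq_add_of_le hml
      have hdeg : l * d - s + d * e + s = (m + 1) * d := by
        rw [he, add_mul, mul_comm d e]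
        omega
      obtain ⟨c, hc, hac⟩ := exists_divergence_free_of_divergence_eq hd hf hf0 hH
        m.succ_ne_zero hdeg (ha.mul (hf.pow e)) b (by
          refine mul_left_cancel₀ (pow_ne_zero l hf0) (Eq.trans ?_ hb)
          rw [he]
          ring)
      rcases Nat.eq_zero_or_pos e with rfl | he0
      · rw [pow_zero, mul_one] at hac
        rw [hac]
        exact Ideal.sum_mem _ fun j _ => Ideal.mul_mem_left _ _ (Ideal.subset_span ⟨j, rfl⟩)
      · have hm : (m : L) ≠ 0 := Nat.cast_ne_zero.mpr (by omega)
        refine ih (fun j => C (-(m : L)⁻¹) * c j) ?_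
        have hCm : (m : MvPolynomial (Fin s) L) * C (-(m : L)⁻¹) = -1 := by
          rw [← map_natCast (C (R := L) (σ := Fin s)), ← C_mul, mul_neg,
            mul_inv_cancel₀ hm, C_neg, C_1]
        have h : ∑ j, (f * pderiv j (C (-(m : L)⁻¹) * c j)
            - (m : MvPolynomial (Fin s) L) * (C (-(m : L)⁻¹) * c j) * pderiv j f)
            = f * C (-(m : L)⁻¹) * ∑ j, pderiv j (c j) + ∑ j, c j * pderiv j f := by
          rw [Finset.mul_sum, ← Finset.sum_add_distrib]
          refine Finset.sum_congr rfl fun j _ => ?_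
          rw [pderiv_C_mul]
          linear_combination (-c j * pderiv j f) * hCm
        rw [h, hc, mul_zero, zero_add, ← hac, he]
        ring

end Jacobian

/-- Linear independence modulo derivatives (Proposition 2): if
`(Σ_{l=1}^{l0} g_l·f^{l0−l})/f^{l0}` lies in `D_f`, then the top coefficient `g_{l0}`
lies in the Jacobian ideal of `f`. -/
theorem top_coefficient_in_jacobian {L : Type*} [Field L] [CharZero L]
    (n : ℕ) (hn : 1 ≤ n) (d : ℕ) (hd : 1 ≤ d)
    (f : MvPolynomial (Fin (n + 1)) L) (hf : f.IsHomogeneous d)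
    (hH : Module.Finite L
      (MvPolynomial (Fin (n + 1)) L ⧸
        Ideal.span (Set.range fun i : Fin (n + 1) => pderiv i f)))
    (l0 : ℕ) (hl0 : 1 ≤ l0) (g : ℕ → MvPolynomial (Fin (n + 1)) L)
    (hg : ∀ l ∈ Finset.Icc 1 l0,
      (g l).IsHomogeneous (l * d - (n + 1)) ∧ (l * d < n + 1 → g l = 0))
    (hD : ∃ (m : ℕ) (b : Fin (n + 1) → MvPolynomial (Fin (n + 1)) L),
      (∑ l ∈ Finset.Icc 1 l0, g l * f ^ (l0 - l)) * f ^ (m + 1)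
        = f ^ l0 * ∑ i : Fin (n + 1),
            (f * pderiv i (b i)
              - (m : MvPolynomial (Fin (n + 1)) L) * b i * pderiv i f)) :
    g l0 ∈ Ideal.span (Set.range fun i : Fin (n + 1) => pderiv i f) := by
  by_cases hdeg : l0 * d < n + 1
  · rw [(hg l0 (Finset.right_mem_Icc.mpr hl0)).2 hdeg]
    exact zero_mem _
  rw [not_lt] at hdeg
  have hf0 : f ≠ 0 := by
    rintro rfl
    obtain ⟨N, hN⟩ := exists_X_pow_mem_of_finite (isHomogeneous_jacobian hf) hH 0
    simp at hN
  obtain ⟨m, b, hb⟩ := hD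
  have ha : (∑ l ∈ Finset.Icc 1 l0, g l * f ^ (l0 - l)).IsHomogeneous (l0 * d - (n + 1)) := by
    refine IsHomogeneous.sum _ _ _ fun l hl => ?_
    obtain ⟨hl₁, hl₂⟩ := hg l hl
    by_cases h : l * d < n + 1
    · rw [hl₂ h, zero_mul]
      exact isHomogeneous_zero _ _ _
    · convert hl₁.mul (hf.pow (l0 - l)) using 1
      have := Nat.mul_le_mul_right d (Finset.mem_Icc.mp hl).2
      rw [Nat.mul_comm d, Nat.sub_mul]
      omega
  have hmem := mem_jacobian_of_divergence_eq hd hf hf0 hH hl0 (by simpa using hdeg)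
    (by simpa using ha) m b hb
  rw [← Finset.sum_erase_add _ _ (Finset.right_mem_Icc.mpr hl0), Nat.sub_self, pow_zero,
    mul_one] at hmem
  refine (Ideal.add_mem_iff_right _ (Ideal.sum_mem _ fun l hl => ?_)).mp hmem
  obtain ⟨hne, hl⟩ := Finset.mem_erase.mp hl
  have hpos : l0 - l ≠ 0 := by
    have := (Finset.mem_Icc.mp hl).2
    omega
  exact Ideal.mul_mem_left _ _ (Ideal.pow_mem_of_mem _
    (self_mem_jacobian (by omega) hf) _ (Nat.pos_of_ne_zero hpos))
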